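/- Let a and b be coprime positive integers. Then the sum of the elements of NR(a,b) equals (a−1)(b−1)(2ab − a − b − 1)/12. -/

import Mathlib

open Finset in
theorem mul_mod_injOn_range {a b : ℕ} (hab : Nat.Coprime a b) :
    Set.InjOn (fun i => b * i % a) (range a : Finset ℕ) := by
  intro i hi j hj h
  simp only [coe_range, Set.mem_Iio] at hi hj
  have h' : i ≡ j [MOD a] := Nat.ModEq.cancel_left_of_coprime hab h
  exact h'.eq_of_lt_of_lt hi hj

open Finset in
theorem image_mul_mod_range {a b : ℕ} (ha : 0 < a) (hab : Nat.Coprime a b) :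
    (range a).image (fun i => b * i % a) = range a := by
  apply eq_of_subset_of_card_le
  · intro x hx
    obtain ⟨i, -, rfl⟩ := mem_image.1 hx
    exact mem_range.2 (Nat.mod_lt _ ha)
  · rw [card_image_of_injOn (mul_mod_injOn_range hab)]

open Finset in
theorem sum_mul_mod_range {M : Type*} [AddCommMonoid M] {a b : ℕ} (ha : 0 < a)
    (hab : Nat.Coprime a b) (f : ℕ → M) :
    ∑ i ∈ range a, f (b * i % a) = ∑ i ∈ range a, f i := by
  conv_rhs => rw [← image_mul_mod_range ha hab]
  rw [sum_image (mul_mod_injOn_range hab)]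

open Finset in
/-- The nonrepresentable numbers congruent to `b * i` modulo `a` are those below `b * i`. -/
theorem nonrepresentable_eq_image {a b : ℕ} (ha : 0 < a) (hab : Nat.Coprime a b) :
    {n : ℕ | ¬ ∃ x y : ℕ, n = a * x + b * y} =
      (((range a).sigma fun i => range (b * i / a)).image
        fun p : (_ : ℕ) × ℕ => b * p.1 % a + a * p.2 : Finset ℕ) := by
  ext n
  simp only [Set.mem_ofPred_eq, coe_image, Set.mem_image, mem_coe, mem_sigma, mem_range]
  constructor
  · intro h
    have hn : n % a ∈ (range a).image (fun i => b * i % a) := by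
      rw [image_mul_mod_range ha hab]
      exact mem_range.2 (Nat.mod_lt _ ha)
    obtain ⟨i, hi, hin⟩ := mem_image.1 hn
    refine ⟨⟨i, n / a⟩, ⟨mem_range.1 hi, ?_⟩, ?_⟩
    · by_contra! hle
      refine h ⟨n / a - b * i / a, i, ?_⟩
      have h1 := Nat.mod_add_div n a
      have h2 := Nat.mod_add_div (b * i) a
      have h3 : a * (b * i / a) ≤ a * (n / a) := Nat.mul_le_mul_left a hle
      dsimp only at hin hle h3
      rw [Nat.mul_sub]
      omega
    · dsimp only at hin ⊢
      rw [hin, Nat.mod_add_div]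
  · rintro ⟨⟨i, k⟩, ⟨hi, hk⟩, rfl⟩ ⟨x, y, hxy⟩
    dsimp only at hi hk hxy
    have hmod : b * i ≡ b * y [MOD a] := by
      have h := congrArg (· % a) hxy
      simpa [Nat.ModEq] using h
    have hiy : i % a = y % a := Nat.ModEq.cancel_left_of_coprime hab hmod
    rw [Nat.mod_eq_of_lt hi] at hiy
    have hle : b * i ≤ b * y := Nat.mul_le_mul_left b (hiy ▸ Nat.mod_le y a)
    have h2 := Nat.mod_add_div (b * i) a
    have h3 : a * k < a * (b * i / a) := Nat.mul_lt_mul_of_pos_left hk ha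
    omega

open Finset in
theorem sum_range_cast_id (n : ℕ) : ∑ i ∈ range n, (i : ℚ) = n * (n - 1) / 2 := by
  induction n with
  | zero => simp
  | succ n ih => rw [sum_range_succ, ih]; push_cast; ring

open Finset in
theorem sum_range_cast_sq (n : ℕ) :
    ∑ i ∈ range n, (i : ℚ) ^ 2 = n * (n - 1) * (2 * n - 1) / 6 := by
  induction n with
  | zero => simp
  | succ n ih => rw [sum_range_succ, ih]; push_cast; ring

open Finset in
theorem stmt_10 (a b : ℕ) (ha : 0 < a) (hb : 0 < b) (hab : Nat.Coprime a b) :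
    ∑ᶠ n ∈ {n : ℕ | ¬ ∃ x y : ℕ, n = a * x + b * y}, (n : ℚ) =
      ((a : ℚ) - 1) * ((b : ℚ) - 1) * (2 * (a : ℚ) * b - a - b - 1) / 12 := by
  have ha' : (a : ℚ) ≠ 0 := by positivity
  rw [nonrepresentable_eq_image ha hab, finsum_mem_coe_finset, sum_image, sum_sigma]
  · have hclass : ∀ i ∈ range a,
        ∑ k ∈ range (b * i / a), ((b * i % a + a * k : ℕ) : ℚ) =
          ((b : ℚ) ^ 2 * (i : ℚ) ^ 2 - ((b * i % a : ℕ) : ℚ) ^ 2) / (2 * a) -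
            (b * (i : ℚ) - ((b * i % a : ℕ) : ℚ)) / 2 := by
      intro i _
      have h : ((b * i % a : ℕ) : ℚ) + a * ((b * i / a : ℕ) : ℚ) = b * i := by
        exact_mod_cast Nat.mod_add_div (b * i) a
      simp only [Nat.cast_add, Nat.cast_mul, sum_add_distrib, ← mul_sum, sum_range_cast_id,
        sum_const, card_range, nsmul_eq_mul]
      rw [← mul_pow, ← h]
      field_simp
      ring
    rw [sum_congr rfl hclass, sum_sub_distrib, ← sum_div, ← sum_div, sum_sub_distrib,
      sum_sub_distrib, ← mul_sum, ← mul_sum,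
      sum_mul_mod_range ha hab (fun r => (r : ℚ) ^ 2), sum_mul_mod_range ha hab (fun r => (r : ℚ)),
      sum_range_cast_id, sum_range_cast_sq]
    field_simp
    ring
  · rintro ⟨i, k⟩ hp ⟨j, l⟩ hq h
    simp only [coe_sigma, Set.mem_sigma_iff, mem_coe] at hp hq
    dsimp only at h
    have hij : i = j := by
      refine mul_mod_injOn_range hab hp.1 hq.1 ?_
      simpa using congrArg (· % a) h
    subst hij
    have hkl : k = l := Nat.eq_of_mul_eq_mul_left ha (Nat.add_left_cancel h)
    rw [hkl]
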